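/- Let V be a nonempty finite set, c ∈ ℤ₂, O = {a ∈ ℤ₂^V : Σ_{j∈V} a_j = c}, and let {P_a}_{a∈O} and {Q_b}_{b∈ℤ₂} be projective measurements on a complex Hilbert space H such that ‖P_a Q_b − Q_b P_a‖ ≤ δ in operator norm for all a ∈ O and b ∈ ℤ₂. Set A_j := Σ_{a∈O} (−1)^{a_j} P_a for j ∈ V and B := Q_0 − Q_1. Then ‖A_j B A_j B − Id‖ ≤ 2^{|V|+1} δ for all j ∈ V (equivalently, since A_j and B are self-adjoint unitaries, the commutator [A_j, B] = A_j B A_j^{-1} B^{-1} satisfies ‖[A_j, B] − Id‖ ≤ 2^{|V|+1} δ). -/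

import Mathlib

/-- A projective measurement on a complex Hilbert space `H`, indexed by a finite set `O`:
a family of self-adjoint projections that are mutually orthogonal and sum to the identity. -/
structure IsProjectiveMeasurement {H : Type*} [NormedAddCommGroup H] [InnerProductSpace ℂ H]
    [CompleteSpace H] {O : Type*} [Fintype O] (P : O → H →L[ℂ] H) : Prop where
  selfAdjoint : ∀ a, IsSelfAdjoint (P a)
  idem : ∀ a, P a * P a = P a
  orth : ∀ a a', a ≠ a' → P a * P a' = 0
  total : ∑ a, P a = 1

/-- The observable `A_j = Σ_{a ∈ O} (−1)^{a_j} P_a` associated to a measurement indexed by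
`O = {a ∈ ℤ₂^V : Σ_j a_j = c}`. -/
noncomputable def Aobs {V : Type*} [Fintype V] [DecidableEq V]
    {H : Type*} [NormedAddCommGroup H] [InnerProductSpace ℂ H] [CompleteSpace H]
    (c : ZMod 2) (P : {a : V → ZMod 2 // ∑ j, a j = c} → H →L[ℂ] H) (j : V) :
    H →L[ℂ] H :=
  ∑ a, ((-1 : ℂ) ^ (a.1 j).val) • P a

/-- The observable `B = Q_0 − Q_1` associated to a binary measurement. -/
noncomputable def Bobs {H : Type*} [NormedAddCommGroup H] [InnerProductSpace ℂ H]
    [CompleteSpace H] (Q : ZMod 2 → H →L[ℂ] H) : H →L[ℂ] H :=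
  Q 0 - Q 1

lemma norm_le_one_of_sa_sq {H : Type*} [NormedAddCommGroup H] [InnerProductSpace ℂ H]
    [CompleteSpace H] (A : H →L[ℂ] H) (hA : IsSelfAdjoint A) (h : A * A = 1) : ‖A‖ ≤ 1 := by
  have h1 : ‖A * A‖ = ‖A‖ * ‖A‖ := by
    have := CStarRing.norm_star_mul_self (x := A)
    rwa [hA.star_eq] at this
  have h2 : ‖(1 : H →L[ℂ] H)‖ ≤ 1 := ContinuousLinearMap.norm_id_le
  rw [h] at h1
  nlinarith [norm_nonneg A]

lemma Aobs_sq {V : Type*} [Fintype V] [DecidableEq V]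
    {H : Type*} [NormedAddCommGroup H] [InnerProductSpace ℂ H] [CompleteSpace H]
    (c : ZMod 2) (P : {a : V → ZMod 2 // ∑ j, a j = c} → H →L[ℂ] H)
    (hP : IsProjectiveMeasurement P) (j : V) : Aobs c P j * Aobs c P j = 1 := by
  unfold Aobs
  rw [← hP.total, Finset.sum_mul]
  refine Finset.sum_congr rfl fun a _ => ?_
  rw [Finset.mul_sum, Finset.sum_eq_single a]
  · rw [smul_mul_smul_comm, hP.idem, ← mul_pow]
    simp
  · intro b _ hb
    rw [smul_mul_smul_comm, hP.orth _ _ hb.symm, smul_zero]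
  · simp

lemma Aobs_sa {V : Type*} [Fintype V] [DecidableEq V]
    {H : Type*} [NormedAddCommGroup H] [InnerProductSpace ℂ H] [CompleteSpace H]
    (c : ZMod 2) (P : {a : V → ZMod 2 // ∑ j, a j = c} → H →L[ℂ] H)
    (hP : IsProjectiveMeasurement P) (j : V) : IsSelfAdjoint (Aobs c P j) := by
  unfold Aobs IsSelfAdjoint
  rw [star_sum]
  refine Finset.sum_congr rfl fun a _ => ?_
  rw [star_smul, (hP.selfAdjoint a).star_eq]
  simp

lemma Bobs_sq {H : Type*} [NormedAddCommGroup H] [InnerProductSpace ℂ H] [CompleteSpace H]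
    (Q : ZMod 2 → H →L[ℂ] H) (hQ : IsProjectiveMeasurement Q) : Bobs Q * Bobs Q = 1 := by
  have ht : Q 0 + Q 1 = 1 := by
    rw [← hQ.total]
    exact (Fin.sum_univ_two Q).symm
  unfold Bobs
  rw [sub_mul, mul_sub, mul_sub, hQ.idem, hQ.idem, hQ.orth 0 1 (by decide),
    hQ.orth 1 0 (by decide), ← ht]
  abel

lemma comm_bound {V : Type*} [Fintype V] [DecidableEq V]
    {H : Type*} [NormedAddCommGroup H] [InnerProductSpace ℂ H] [CompleteSpace H]
    (c : ZMod 2) (δ : ℝ)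
    (P : {a : V → ZMod 2 // ∑ j, a j = c} → H →L[ℂ] H) (Q : ZMod 2 → H →L[ℂ] H)
    (hδ : ∀ a b, ‖P a * Q b - Q b * P a‖ ≤ δ) (j : V) :
    ‖Aobs c P j * Bobs Q - Bobs Q * Aobs c P j‖ ≤
      (Fintype.card {a : V → ZMod 2 // ∑ j, a j = c} : ℝ) * (2 * δ) := by
  unfold Aobs
  rw [Finset.sum_mul, Finset.mul_sum, ← Finset.sum_sub_distrib]
  refine (norm_sum_le_of_le (n := fun _ => 2 * δ) _ fun a _ => ?_).trans (by simp)
  rw [smul_mul_assoc, mul_smul_comm, ← smul_sub, norm_smul]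
  have e : P a * Bobs Q - Bobs Q * P a =
      (P a * Q 0 - Q 0 * P a) - (P a * Q 1 - Q 1 * P a) := by
    unfold Bobs
    rw [mul_sub, sub_mul]; abel
  have := norm_sub_le (P a * Q 0 - Q 0 * P a) (P a * Q 1 - Q 1 * P a)
  rw [e]
  simp only [norm_pow, norm_neg, norm_one, one_pow, one_mul]
  linarith [hδ a 0, hδ a 1]

/-- if `{P_a}` and `{Q_b}` are projective measurements whose elements
`δ`-approximately commute, then the associated observables satisfy
`‖A_j B A_j B − Id‖ ≤ 2^{|V|+1} δ` for all `j ∈ V`. -/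
theorem observables_approx_commute {V : Type*} [Fintype V] [DecidableEq V] [Nonempty V]
    {H : Type*} [NormedAddCommGroup H] [InnerProductSpace ℂ H] [CompleteSpace H]
    (c : ZMod 2) (δ : ℝ)
    (P : {a : V → ZMod 2 // ∑ j, a j = c} → H →L[ℂ] H) (Q : ZMod 2 → H →L[ℂ] H)
    (hP : IsProjectiveMeasurement P) (hQ : IsProjectiveMeasurement Q)
    (hδ : ∀ a b, ‖P a * Q b - Q b * P a‖ ≤ δ) :
    ∀ j, ‖Aobs c P j * Bobs Q * Aobs c P j * Bobs Q - 1‖ ≤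
      2 ^ (Fintype.card V + 1) * δ := by
  intro j
  have hδ0 : 0 ≤ δ :=
    (norm_nonneg _).trans (hδ ⟨Pi.single j c, by simp⟩ 0)
  have hA := Aobs_sq c P hP j
  have hB := Bobs_sq Q hQ
  have nA := norm_le_one_of_sa_sq _ (Aobs_sa c P hP j) hA
  have nB := norm_le_one_of_sa_sq (Bobs Q) ((hQ.selfAdjoint 0).sub (hQ.selfAdjoint 1)) hB
  have hc := comm_bound c δ P Q hδ j
  have hcard : (Fintype.card {a : V → ZMod 2 // ∑ j, a j = c} : ℝ) ≤ 2 ^ Fintype.card V := by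
    have := Fintype.card_subtype_le (fun a : V → ZMod 2 => ∑ j, a j = c)
    rw [Fintype.card_fun, ZMod.card] at this
    exact_mod_cast this
  generalize Aobs c P j = A at *
  generalize Bobs Q = B at *
  have e : A * B * A * B - 1 = (A * B - B * A) * (A * B) := by
    rw [sub_mul, ← mul_assoc, mul_assoc B A (A * B), ← mul_assoc A A B, hA, one_mul, hB]
  have nAB : ‖A * B‖ ≤ 1 :=
    (norm_mul_le _ _).trans (mul_le_one₀ nA (norm_nonneg _) nB)
  rw [e]
  calc ‖(A * B - B * A) * (A * B)‖ ≤ ‖A * B - B * A‖ * ‖A * B‖ := norm_mul_le _ _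
    _ ≤ ‖A * B - B * A‖ := mul_le_of_le_one_right (norm_nonneg _) nAB
    _ ≤ _ := hc
    _ ≤ 2 ^ Fintype.card V * (2 * δ) := by gcongr
    _ = _ := by ring
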